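/- Define directions Δ = {→, ←, ↷₁, ↶₁, ↷₂, ↶₂}, where in a nested word over a 2-stack call-return alphabet → moves to the successor position, ← to the predecessor, ↷_s follows a μ^s-edge forward from a call of stack s, and ↶_s follows a μ^s-edge backward from a return of stack s. Call a string w ∈ Δ⁺ circular if there exist a nested word W over a 2-stack call-return alphabet and a position i with a w-labeled path from i back to i whose intermediate positions i₀=i, i₁, …, i_{m−1} are pairwise distinct and i_m = i avoids i₁,…,i_{m−1}. Then for every circular string w and every k ≥ 2, the string w^k is not circular. -/

import Mathlib

/-- The *kind* of a letter in a `K`-stack call-return alphabet: a call of some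
stack `s`, a return of some stack `s`, or an internal action. -/
inductive CRKind (K : ℕ) where
  | call (s : Fin K)
  | ret (s : Fin K)
  | int

/-- A `K`-stack call-return alphabet over the letters `A`: every letter is
(exclusively) a call of one stack, a return of one stack, or internal.  This
encodes the pairwise disjointness of the collection
`⟨{(Σ_c^s, Σ_r^s)}_{s∈[K]}, Σ_int⟩` together with `Σ` being their union. -/
structure CRAlphabet (K : ℕ) (A : Type) where
  kind : A → CRKind K

namespace CRAlphabet

variable {K : ℕ} {A : Type}

def callSet (h : CRAlphabet K A) (s : Fin K) : Set A := {a | h.kind a = .call s}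
def retSet (h : CRAlphabet K A) (s : Fin K) : Set A := {a | h.kind a = .ret s}
def intSet (h : CRAlphabet K A) : Set A := {a | h.kind a = .int}

end CRAlphabet

/-- `s`-well-formed strings: generated by the grammar
`A ::= aAb | AA | ε | c` with `a ∈ c`, `b ∈ r`, `c ∉ c ∪ r`. -/
inductive SWellFormed {A : Type} (c r : Set A) : List A → Prop where
  | nil : SWellFormed c r []
  | single {x : A} : x ∉ c → x ∉ r → SWellFormed c r [x]
  | wrap {a b : A} {u : List A} : a ∈ c → b ∈ r → SWellFormed c r u →
      SWellFormed c r (a :: u ++ [b])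
  | concat {u v : List A} : SWellFormed c r u → SWellFormed c r v →
      SWellFormed c r (u ++ v)

/-- The matching relation `μ^s` of the nested word determined by the string
`w` (positions `0`-based): `(i,j) ∈ μ^s` iff `i < j`, `λ(i) ∈ Σ_c^s`,
`λ(j) ∈ Σ_r^s` and `λ(i+1) … λ(j-1)` is `s`-well formed. -/
def Matched {K : ℕ} {A : Type} (h : CRAlphabet K A) (w : List A) (s : Fin K)
    (i j : ℕ) : Prop :=
  i < j ∧ j < w.length ∧
  (∃ a, w[i]? = some a ∧ a ∈ h.callSet s) ∧
  (∃ b, w[j]? = some b ∧ b ∈ h.retSet s) ∧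
  SWellFormed (h.callSet s) (h.retSet s) ((w.take j).drop (i + 1))

/-- The full matching relation `μ = ⋃_s μ^s`. -/
def MuAny {K : ℕ} {A : Type} (h : CRAlphabet K A) (w : List A) (i j : ℕ) : Prop :=
  ∃ s, Matched h w s i j

/-- The six directions `Δ = {→, ←, ↷₁, ↶₁, ↷₂, ↶₂}` for 2-stack nested
words. -/
inductive Dir where
  | right | left | call1 | ret1 | call2 | ret2

/-- One step in direction `d` inside the nested word of `w`. -/
def dirStep {A : Type} (h : CRAlphabet 2 A) (w : List A) :
    Dir → ℕ → ℕ → Prop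
  | .right, i, j => j = i + 1 ∧ j < w.length
  | .left, i, j => i = j + 1 ∧ i < w.length
  | .call1, i, j => Matched h w 0 i j
  | .call2, i, j => Matched h w 1 i j
  | .ret1, i, j => Matched h w 0 j i
  | .ret2, i, j => Matched h w 1 j i

/-- `is` is a `ds`-labeled path in the nested word of `w`. -/
def dirPath {A : Type} (h : CRAlphabet 2 A) (w : List A) :
    List Dir → List ℕ → Prop
  | [], is => ∃ i, is = [i]
  | d :: ds, is =>
      ∃ i j rest, is = i :: j :: rest ∧ dirStep h w d i j ∧
        dirPath h w ds (j :: rest)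

/-- A simple `ds`-cycle at position `i`: a `ds`-labeled path from `i` back to
`i` whose positions `i₀ = i, i₁, …, i_{m-1}` are pairwise distinct (and hence
the endpoint `i_m = i₀` avoids `i₁, …, i_{m-1}`). -/
def SimpleCycle {A : Type} (h : CRAlphabet 2 A) (w : List A) (ds : List Dir)
    (i : ℕ) : Prop :=
  ∃ is : List ℕ, dirPath h w ds is ∧ is.head? = some i ∧
    is.getLast? = some i ∧ is.dropLast.Nodup

/-- `ds ∈ Δ⁺` is circular: some nested word over some 2-stack call-return
alphabet contains a simple `ds`-cycle. -/
def Circular (ds : List Dir) : Prop :=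
  ∃ (A : Type) (h : CRAlphabet 2 A) (w : List A) (i : ℕ),
    SimpleCycle h w ds i

/-- Cyclic successor on `{0, …, n - 1}`. -/
def cycNext (n k : ℕ) : ℕ := if k + 1 < n then k + 1 else 0

/-- Cyclic predecessor on `{0, …, n - 1}`. -/
def cycPrev (n k : ℕ) : ℕ := if k = 0 then n - 1 else k - 1

/-- Rotation by `c` on `{0, …, n - 1}`. -/
def cycRot (n c k : ℕ) : ℕ := if k + c < n then k + c else k + c - n

theorem cycNext_lt {n k : ℕ} (h : k < n) : cycNext n k < n := by
  unfold cycNext; split_ifs <;> omega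

theorem cycPrev_lt {n k : ℕ} (h : k < n) : cycPrev n k < n := by
  unfold cycPrev; split_ifs <;> omega

theorem cycRot_lt {n c k : ℕ} (hc : c < n) (h : k < n) : cycRot n c k < n := by
  unfold cycRot; split_ifs <;> omega

theorem cycNext_of_lt {n k : ℕ} (h : k + 1 < n) : cycNext n k = k + 1 := if_pos h

theorem cycNext_last (n : ℕ) : cycNext (n + 1) n = 0 := if_neg (lt_irrefl _)

theorem cycNext_cycPrev {n k : ℕ} (h : k < n) : cycNext n (cycPrev n k) = k := by
  unfold cycNext cycPrev; split_ifs <;> omega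

theorem cycPrev_cycNext {n k : ℕ} (h : k < n) : cycPrev n (cycNext n k) = k := by
  have : k + 1 < n ∧ cycNext n k = k + 1 ∨ k + 1 = n ∧ cycNext n k = 0 := by
    unfold cycNext; split_ifs <;> omega
  unfold cycPrev; split_ifs <;> omega

theorem cycRot_cycNext {n c k : ℕ} (hc : c < n) (h : k < n) :
    cycRot n c (cycNext n k) = cycNext n (cycRot n c k) := by
  unfold cycNext cycRot; split_ifs <;> omega

theorem cycRot_cycPrev {n c k : ℕ} (hc : c < n) (h : k < n) :
    cycRot n c (cycPrev n k) = cycPrev n (cycRot n c k) := by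
  unfold cycPrev cycRot; split_ifs <;> omega

theorem sum_cycRot {n c : ℕ} (hc : c < n) (f : ℕ → ℤ) :
    ∑ k ∈ Finset.range n, f (cycRot n c k) = ∑ k ∈ Finset.range n, f k := by
  refine Finset.sum_nbij' (cycRot n c) (fun k => if c ≤ k then k - c else k + n - c) ?_ ?_ ?_ ?_ ?_
  · intro k hk
    simp only [Finset.mem_range] at *
    exact cycRot_lt hc hk
  · intro k hk
    simp only [Finset.mem_range] at *
    split_ifs <;> omega
  · intro k hk
    simp only [Finset.mem_range, cycRot] at *
    split_ifs <;> omega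
  · intro k hk
    simp only [Finset.mem_range, cycRot] at *
    split_ifs <;> omega
  · intro k _
    rfl

theorem sum_cycNext (n : ℕ) (f : ℕ → ℤ) :
    ∑ k ∈ Finset.range n, f (cycNext n k) = ∑ k ∈ Finset.range n, f k := by
  refine Finset.sum_nbij' (cycNext n) (cycPrev n) ?_ ?_ ?_ ?_ ?_
  · intro k hk
    simp only [Finset.mem_range] at *
    exact cycNext_lt hk
  · intro k hk
    simp only [Finset.mem_range] at *
    exact cycPrev_lt hk
  · intro k hk
    exact cycPrev_cycNext (Finset.mem_range.1 hk)
  · intro k hk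
    exact cycNext_cycPrev (Finset.mem_range.1 hk)
  · intro k _
    rfl

/-- `c` lies strictly between `a` and `b`. -/
def Between (a b c : ℤ) : Prop := (a < c ∧ c < b) ∨ (b < c ∧ c < a)

/-- `c` lies strictly outside the interval spanned by `a` and `b`. -/
def Outside (a b c : ℤ) : Prop := (c < a ∧ c < b) ∨ (a < c ∧ b < c)

/-- The semicircles spanned by `{a, b}` and `{c, d}` in the same half plane do not cross. -/
def NonCrossing (a b c d : ℤ) : Prop :=
  ¬ (Between a b c ∧ Outside a b d) ∧ ¬ (Outside a b c ∧ Between a b d)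

/-- The orientation of the step from `a` to `b`. -/
def stepSign (a b : ℤ) : ℤ := if a < b then 1 else -1

/-- The cyclic orientation of the triple `(a, b, c)`. -/
def cycSign (a b c : ℤ) : ℤ :=
  if (a < b ∧ b < c) ∨ (b < c ∧ c < a) ∨ (c < a ∧ a < b) then 1 else -1

/-- The turning attributed to the edge from `p` to `q`, with predecessor `a` and successor `b`. -/
def edgeTurn (a p q b : ℤ) : ℤ := 2 * stepSign p q - cycSign a p q - cycSign p q b

/-- A simple closed curve through the points `x 0, …, x (n - 1)` of a line.  The edge leaving `x i`
is a semicircle in one of the half planes if `e i = ± 1`, and a segment if `e i = 0`. -/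
structure ArcCycle (n : ℕ) (x e : ℕ → ℤ) : Prop where
  inj : ∀ i < n, ∀ j < n, x i = x j → i = j
  label : ∀ i < n, e i = 1 ∨ e i = 0 ∨ e i = -1
  nonCrossing : ∀ i < n, ∀ j < n, e i = e j → e i ≠ 0 →
    NonCrossing (x i) (x (cycNext n i)) (x j) (x (cycNext n j))
  flat : ∀ i < n, e i = 0 → ∀ j < n, ¬ Between (x i) (x (cycNext n i)) (x j)
  alternating : ∀ i < n, e i = e (cycNext n i) → e i = 0

/-- Twice the turning number of the curve described by `ArcCycle n x e`, in half turns. -/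
def turning (n : ℕ) (x e : ℕ → ℤ) : ℤ :=
  ∑ k ∈ Finset.range n, e k *
    edgeTurn (x (cycPrev n k)) (x k) (x (cycNext n k)) (x (cycNext n (cycNext n k)))

/-- The signed number of semicircles. -/
def arcSum (n : ℕ) (x e : ℕ → ℤ) : ℤ :=
  ∑ k ∈ Finset.range n, e k * stepSign (x k) (x (cycNext n k))

namespace ArcCycle

variable {n : ℕ} {x e : ℕ → ℤ}

theorem rotate (h : ArcCycle n x e) {c : ℕ} (hc : c < n) :
    ArcCycle n (x ∘ cycRot n c) (e ∘ cycRot n c) where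
  inj i hi j hj hij := by
    have := h.inj _ (cycRot_lt hc hi) _ (cycRot_lt hc hj) hij
    unfold cycRot at this
    split_ifs at this <;> omega
  label i hi := h.label _ (cycRot_lt hc hi)
  nonCrossing i hi j hj := by
    simp only [Function.comp, cycRot_cycNext hc hi, cycRot_cycNext hc hj]
    exact h.nonCrossing _ (cycRot_lt hc hi) _ (cycRot_lt hc hj)
  flat i hi h0 j hj := by
    simp only [Function.comp, cycRot_cycNext hc hi]
    exact h.flat _ (cycRot_lt hc hi) h0 _ (cycRot_lt hc hj)
  alternating i hi := by
    simp only [Function.comp, cycRot_cycNext hc hi]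
    exact h.alternating _ (cycRot_lt hc hi)

end ArcCycle

theorem turning_rotate {n c : ℕ} (hc : c < n) (x e : ℕ → ℤ) :
    turning n (x ∘ cycRot n c) (e ∘ cycRot n c) = turning n x e := by
  unfold turning
  refine Eq.trans ?_ (sum_cycRot hc _)
  refine Finset.sum_congr rfl fun k hk => ?_
  have hk := Finset.mem_range.1 hk
  simp only [Function.comp, cycRot_cycNext hc hk, cycRot_cycPrev hc hk,
    cycRot_cycNext hc (cycNext_lt hk)]

theorem arcSum_rotate {n c : ℕ} (hc : c < n) (x e : ℕ → ℤ) :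
    arcSum n (x ∘ cycRot n c) (e ∘ cycRot n c) = arcSum n x e := by
  unfold arcSum
  refine Eq.trans ?_ (sum_cycRot hc _)
  refine Finset.sum_congr rfl fun k hk => ?_
  simp only [Function.comp, cycRot_cycNext hc (Finset.mem_range.1 hk)]

theorem exists_cycRot_eq {n i j : ℕ} (hi : i < n) (hj : j < n) :
    ∃ c < n, cycRot n c j = i := by
  refine ⟨if j ≤ i then i - j else i + n - j, ?_, ?_⟩
  · split_ifs <;> omega
  · unfold cycRot; split_ifs <;> omega

namespace ArcCycle

variable {n : ℕ} {x e : ℕ → ℤ}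

theorem neg_label (h : ArcCycle n x e) (h0 : ∀ i < n, e i ≠ 0) {i : ℕ} (hi : i < n) :
    e (cycNext n i) = - e i := by
  have h1 := h.label i hi
  have h2 := h.label _ (cycNext_lt hi)
  have h3 := h0 i hi
  have h4 := h0 _ (cycNext_lt hi)
  have h5 := mt (h.alternating i hi) h3
  omega

/-- A cycle of semicircles has one joining two neighbouring points. -/
theorem exists_flat (h : ArcCycle n x e) (h0 : ∀ i < n, e i ≠ 0) (hn : 0 < n) :
    ∃ i < n, ∀ j < n, ¬ Between (x i) (x (cycNext n i)) (x j) := by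
  obtain ⟨i, hi, hmin⟩ := Finset.exists_min_image (Finset.range n)
    (fun i => |x i - x (cycNext n i)|) ⟨0, by simpa using hn⟩
  simp only [Finset.mem_range] at hi hmin
  refine ⟨i, hi, fun j hj hb => ?_⟩
  have key : ∀ k < n, e i = e k → (k = j ∨ cycNext n k = j) → False := by
    intro k hk hek hkj
    have hm := hmin k hk
    have hnc := h.nonCrossing i hi k hk hek (h0 i hi)
    have hki : k ≠ i := by
      rintro rfl
      rcases hkj with rfl | rfl <;> unfold Between at hb <;> omega
    have e1 := h.neg_label h0 hi
    have e2 := h.neg_label h0 hk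
    have e3 := h0 i hi
    have d1 : x k ≠ x i := fun hh => hki (h.inj _ hk _ hi hh)
    have d2 : x (cycNext n k) ≠ x (cycNext n i) := fun hh => hki (by
      have := h.inj _ (cycNext_lt hk) _ (cycNext_lt hi) hh
      rw [← cycPrev_cycNext hk, this, cycPrev_cycNext hi])
    have d3 : x k ≠ x (cycNext n i) := fun hh => by
      rw [h.inj _ hk _ (cycNext_lt hi) hh] at hek
      omega
    have d4 : x (cycNext n k) ≠ x i := fun hh => by
      rw [h.inj _ (cycNext_lt hk) _ hi hh] at e2
      omega
    have d5 : x k ≠ x (cycNext n k) := fun hh => by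
      rw [← h.inj _ hk _ (cycNext_lt hk) hh] at e2
      omega
    unfold NonCrossing Between Outside at hnc
    unfold Between at hb
    simp only [abs_eq_max_neg] at hm
    rcases hkj with rfl | rfl <;> omega
  by_cases hij : e i = e j
  · exact key j hj hij (Or.inl rfl)
  · refine key _ (cycPrev_lt hj) ?_ (Or.inr (cycNext_cycPrev hj))
    have e1 := h.neg_label h0 (cycPrev_lt hj)
    rw [cycNext_cycPrev hj] at e1
    have l1 := h.label i hi
    have l2 := h.label j hj
    have l3 := h0 i hi
    have l4 := h0 j hj
    omega

theorem remove_two {m : ℕ} (h : ArcCycle (m + 4) x e) (h0 : ∀ i < m + 4, e i ≠ 0)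
    (hf : ∀ j < m + 4, ¬ Between (x (m + 2)) (x (m + 3)) (x j)) :
    ArcCycle (m + 2) x e ∧ arcSum (m + 2) x e = arcSum (m + 4) x e := by
  have e1 := h.neg_label h0 (i := m + 1) (by omega)
  have e2 := h.neg_label h0 (i := m + 2) (by omega)
  have e3 := h.neg_label h0 (i := m + 3) (by omega)
  have n1 : cycNext (m + 4) (m + 1) = m + 2 := cycNext_of_lt (by omega)
  have n2 : cycNext (m + 4) (m + 2) = m + 3 := cycNext_of_lt (by omega)
  have n3 : cycNext (m + 4) (m + 3) = 0 := cycNext_last _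
  have n4 : cycNext (m + 2) (m + 1) = 0 := cycNext_last _
  rw [n1] at e1
  rw [n2] at e2
  rw [n3] at e3
  have ne : ∀ i < m + 4, ∀ j < m + 4, i ≠ j → x i ≠ x j :=
    fun i hi j hj hij hx => hij (h.inj i hi j hj hx)
  have nx : ∀ i < m + 2, i = m + 1 ∨
      (i < m + 1 ∧ cycNext (m + 2) i = i + 1 ∧ cycNext (m + 4) i = i + 1) := by
    intro i hi
    by_cases hi' : i = m + 1
    · exact Or.inl hi'
    · exact Or.inr ⟨by omega, cycNext_of_lt (by omega), cycNext_of_lt (by omega)⟩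
  have nc1 := h.nonCrossing (m + 1) (by omega)
  have nc2 := h.nonCrossing (m + 3) (by omega)
  rw [n1] at nc1
  rw [n3] at nc2
  have base : NonCrossing (x (m + 1)) (x (m + 2)) (x (m + 3)) (x 0) := by
    have := nc1 (m + 3) (by omega) (by omega) (h0 _ (by omega))
    rwa [n3] at this
  have f0 := hf 0 (by omega)
  have f1 := hf (m + 1) (by omega)
  have d12 := ne (m + 1) (by omega) (m + 2) (by omega) (by omega)
  have d13 := ne (m + 1) (by omega) (m + 3) (by omega) (by omega)
  have d10 := ne (m + 1) (by omega) 0 (by omega) (by omega)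
  have d23 := ne (m + 2) (by omega) (m + 3) (by omega) (by omega)
  have d20 := ne (m + 2) (by omega) 0 (by omega) (by omega)
  have d30 := ne (m + 3) (by omega) 0 (by omega) (by omega)
  have hnew : ∀ j < m + 1, e (m + 1) = e j →
      NonCrossing (x (m + 1)) (x 0) (x j) (x (j + 1)) ∧
      NonCrossing (x j) (x (j + 1)) (x (m + 1)) (x 0) := by
    intro j hj hej
    have nj : cycNext (m + 4) j = j + 1 := cycNext_of_lt (by omega)
    have hj0 : j ≠ 0 := by
      rintro rfl
      have := h0 0 (by omega)
      omega
    have hjm : j ≠ m := by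
      rintro rfl
      have := h.neg_label h0 (i := j) (by omega)
      rw [nj] at this
      have := h0 j (by omega)
      omega
    have c1 := nc1 j (by omega) hej (h0 _ (by omega))
    have c2 := nc2 j (by omega) (by omega) (h0 _ (by omega))
    rw [nj] at c1 c2
    have fj := hf j (by omega)
    have fj' := hf (j + 1) (by omega)
    have a1 := ne j (by omega) (m + 1) (by omega) (by omega)
    have a2 := ne j (by omega) (m + 2) (by omega) (by omega)
    have a3 := ne j (by omega) (m + 3) (by omega) (by omega)
    have a0 := ne j (by omega) 0 (by omega) (by omega)
    have b1 := ne (j + 1) (by omega) (m + 1) (by omega) (by omega)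
    have b2 := ne (j + 1) (by omega) (m + 2) (by omega) (by omega)
    have b3 := ne (j + 1) (by omega) (m + 3) (by omega) (by omega)
    have b0 := ne (j + 1) (by omega) 0 (by omega) (by omega)
    unfold NonCrossing Between Outside at *
    clear nc1 nc2 nx ne hf
    constructor <;> omega
  constructor
  · constructor
    · exact fun i hi j hj => h.inj i (by omega) j (by omega)
    · exact fun i hi => h.label i (by omega)
    · intro i hi j hj hij hi0
      rcases nx i hi with rfl | ⟨hi1, hi2, hi3⟩ <;> rcases nx j hj with rfl | ⟨hj1, hj2, hj3⟩
      · unfold NonCrossing Between Outside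
        omega
      · rw [n4, hj2]
        exact (hnew j hj1 hij).1
      · rw [n4, hi2]
        exact (hnew i hi1 hij.symm).2
      · have := h.nonCrossing i (by omega) j (by omega) hij hi0
        rwa [hi3, hj3, ← hi2, ← hj2] at this
    · exact fun i hi hi0 => absurd hi0 (h0 i (by omega))
    · intro i hi hie
      rcases nx i hi with rfl | ⟨hi1, hi2, hi3⟩
      · rw [n4] at hie
        omega
      · rw [hi2, ← hi3] at hie
        exact h.alternating i (by omega) hie
  · unfold arcSum
    rw [Finset.sum_range_succ, Finset.sum_range_succ _ (m + 3), Finset.sum_range_succ _ (m + 2),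
      Finset.sum_range_succ _ (m + 1), n1, n2, n3, n4]
    have hs : ∀ k ∈ Finset.range (m + 1), e k * stepSign (x k) (x (cycNext (m + 2) k)) =
        e k * stepSign (x k) (x (cycNext (m + 4) k)) := by
      intro k hk
      have := Finset.mem_range.1 hk
      rw [cycNext_of_lt (by omega), cycNext_of_lt (by omega)]
    rw [Finset.sum_congr rfl hs]
    have hstep : stepSign (x (m + 1)) (x 0) = stepSign (x (m + 1)) (x (m + 2))
        - stepSign (x (m + 2)) (x (m + 3)) + stepSign (x (m + 3)) (x 0) := by
      clear nc1 nc2 nx ne hf hnew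
      unfold NonCrossing Between Outside at *
      unfold stepSign
      split_ifs <;> omega
    have e4 : e (m + 3) = e (m + 1) := by omega
    rw [hstep, e4, e1]
    ring

theorem arcSum_eq (n : ℕ) : ∀ x e : ℕ → ℤ, 2 ≤ n → ArcCycle n x e → (∀ i < n, e i ≠ 0) →
    arcSum n x e = 2 ∨ arcSum n x e = -2 := by
  induction n using Nat.strong_induction_on with
  | _ n ih =>
    intro x e hn h h0
    obtain rfl | rfl | hn4 : n = 2 ∨ n = 3 ∨ 4 ≤ n := by omega
    · have hx : x 0 ≠ x 1 := fun hx => absurd (h.inj 0 (by omega) 1 (by omega) hx) (by omega)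
      have he := h.neg_label h0 (i := 0) (by omega)
      have hl := h.label 0 (by omega)
      have h1 := h0 0 (by omega)
      simp only [arcSum, Finset.sum_range_succ, Finset.sum_range_zero, cycNext, stepSign] at he ⊢
      norm_num at he ⊢
      rw [he]
      rcases hl with hl | hl | hl
      · rw [hl]; split_ifs <;> omega
      · exact absurd hl h1
      · rw [hl]; split_ifs <;> omega
    · have a := h.neg_label h0 (i := 0) (by omega)
      have b := h.neg_label h0 (i := 1) (by omega)
      have c := h.neg_label h0 (i := 2) (by omega)
      have d := h0 0 (by omega)
      norm_num [cycNext] at a b c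
      omega
    · obtain ⟨m, rfl⟩ : ∃ m, n = m + 4 := ⟨n - 4, by omega⟩
      obtain ⟨i, hi, hf⟩ := h.exists_flat h0 (by omega)
      obtain ⟨c, hc, hci⟩ := exists_cycRot_eq (j := m + 2) hi (by omega)
      have hr := h.rotate hc
      have hci' : cycRot (m + 4) c (m + 3) = cycNext (m + 4) i := by
        rw [← hci, ← cycRot_cycNext hc (by omega), cycNext_of_lt (by omega)]
      have h0' : ∀ i < m + 4, (e ∘ cycRot (m + 4) c) i ≠ 0 :=
        fun i hi => h0 _ (cycRot_lt hc hi)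
      obtain ⟨h2, hs⟩ := hr.remove_two h0' (by
        intro j hj
        simp only [Function.comp, hci, hci']
        exact hf _ (cycRot_lt hc hj))
      rw [← arcSum_rotate hc, ← hs]
      exact ih (m + 2) (by omega) _ _ (by omega) h2 fun i hi => h0' i (by omega)

theorem turning_eq_two_mul_arcSum (h : ArcCycle n x e) (h0 : ∀ i < n, e i ≠ 0) :
    turning n x e = 2 * arcSum n x e := by
  have hc := sum_cycNext n fun k =>
    e k * cycSign (x (cycPrev n k)) (x k) (x (cycNext n k))
  have hs : turning n x e = 2 * arcSum n x e
      - ∑ k ∈ Finset.range n, e k * cycSign (x (cycPrev n k)) (x k) (x (cycNext n k))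
      + ∑ k ∈ Finset.range n, e (cycNext n k) * cycSign (x (cycPrev n (cycNext n k)))
        (x (cycNext n k)) (x (cycNext n (cycNext n k))) := by
    unfold turning arcSum edgeTurn
    rw [Finset.mul_sum, ← Finset.sum_sub_distrib, ← Finset.sum_add_distrib]
    refine Finset.sum_congr rfl fun k hk => ?_
    have hk := Finset.mem_range.1 hk
    rw [h.neg_label h0 hk, cycPrev_cycNext hk]
    ring
  rw [hs, hc]
  ring

end ArcCycle

theorem edgeTurn_eq_zero {a p q b : ℤ} (hap : a ≠ p) (haq : a ≠ q) (hbp : b ≠ p)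
    (hbq : b ≠ q) (ha : ¬ Between p q a) (hb : ¬ Between p q b) : edgeTurn a p q b = 0 := by
  unfold Between at ha hb
  unfold edgeTurn stepSign cycSign
  split_ifs <;> omega

theorem edgeTurn_of_between {a b c : ℤ} (h : Between a b c) :
    edgeTurn c a b c = 4 * stepSign a b := by
  unfold Between at h
  unfold edgeTurn stepSign cycSign
  split_ifs <;> omega

theorem between_trichotomy {a b c : ℤ} (hab : a ≠ b) (hac : a ≠ c) (hbc : b ≠ c) :
    (Between a b c ∧ ¬ Between b c a ∧ ¬ Between c a b) ∨
    (¬ Between a b c ∧ Between b c a ∧ ¬ Between c a b) ∨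
    (¬ Between a b c ∧ ¬ Between b c a ∧ Between c a b) := by
  unfold Between
  omega

/-- Segments joining two semicircles of the same half plane are pushed into the other one. -/
def relabel (n : ℕ) (e : ℕ → ℤ) (k : ℕ) : ℤ :=
  if e k = 0 ∧ e (cycPrev n k) = e (cycNext n k) then - e (cycPrev n k) else e k

theorem relabel_of_ne_zero {n : ℕ} {e : ℕ → ℤ} {k : ℕ} (h : e k ≠ 0) : relabel n e k = e k :=
  if_neg fun h' => h h'.1

theorem eq_zero_of_relabel {n : ℕ} {e : ℕ → ℤ} {k : ℕ} (h : relabel n e k = 0) : e k = 0 := by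
  by_contra hk
  exact hk (relabel_of_ne_zero (n := n) hk ▸ h)

theorem relabel_neighbours {n : ℕ} {e : ℕ → ℤ} {k : ℕ} (hk : k < n) (h : relabel n e k = 0) :
    relabel n e (cycPrev n k) ≠ relabel n e (cycNext n k) ∨ relabel n e (cycPrev n k) = 0 := by
  have h0 := eq_zero_of_relabel h
  unfold relabel at *
  rw [cycNext_cycPrev hk, cycPrev_cycNext hk]
  split_ifs at * <;> omega

namespace ArcCycle

variable {n : ℕ} {x e : ℕ → ℤ}

theorem ne (h : ArcCycle n x e) {i j : ℕ} (hi : i < n) (hj : j < n) (hij : i ≠ j) : x i ≠ x j :=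
  fun hx => hij (h.inj i hi j hj hx)

theorem relabel (h : ArcCycle n x e) : ArcCycle n x (relabel n e) where
  inj := h.inj
  label i hi := by
    have h1 := h.label i hi
    have h2 := h.label _ (cycPrev_lt hi)
    unfold _root_.relabel
    split_ifs <;> omega
  nonCrossing i hi j hj hij hi0 := by
    by_cases hei : e i = 0
    · have f1 := h.flat i hi hei j hj
      have f2 := h.flat i hi hei _ (cycNext_lt hj)
      unfold NonCrossing
      tauto
    by_cases hej : e j = 0
    · have f1 := h.flat j hj hej i hi
      have f2 := h.flat j hj hej _ (cycNext_lt hi)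
      unfold NonCrossing Between Outside at *
      omega
    rw [relabel_of_ne_zero hei, relabel_of_ne_zero hej] at hij
    exact h.nonCrossing i hi j hj hij hei
  flat i hi hi0 := h.flat i hi (eq_zero_of_relabel hi0)
  alternating i hi hie := by
    have h1 := h.alternating i hi
    unfold _root_.relabel at *
    rw [cycPrev_cycNext hi] at *
    split_ifs at * <;> omega

theorem turning_relabel (h : ArcCycle n x e) (hn : 3 ≤ n) :
    turning n x (_root_.relabel n e) = turning n x e := by
  refine Finset.sum_congr rfl fun k hk => ?_
  have hk := Finset.mem_range.1 hk
  by_cases hek : e k = 0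
  · have h1 := cycPrev_lt hk
    have h2 := cycNext_lt hk
    have h3 := cycNext_lt h2
    rw [edgeTurn_eq_zero, mul_zero, mul_zero]
    any_goals apply h.ne
    any_goals assumption
    any_goals exact h.flat k hk hek _ (by assumption)
    all_goals
      have a : cycPrev n k + 1 = k ∨ (k = 0 ∧ cycPrev n k + 1 = n) := by
        unfold cycPrev; split_ifs <;> omega
      have b : cycNext n k = k + 1 ∨ (k + 1 = n ∧ cycNext n k = 0) := by
        unfold cycNext; split_ifs <;> omega
      have c : cycNext n (cycNext n k) = cycNext n k + 1 ∨
          (cycNext n k + 1 = n ∧ cycNext n (cycNext n k) = 0) := by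
        generalize cycNext n k = l at *
        unfold cycNext; split_ifs <;> omega
      omega
  · rw [relabel_of_ne_zero hek]

theorem turning_three (h : ArcCycle 3 x e) : turning 3 x e = 4 ∨ turning 3 x e = -4 := by
  have h01 := h.ne (i := 0) (j := 1) (by omega) (by omega) (by omega)
  have h02 := h.ne (i := 0) (j := 2) (by omega) (by omega) (by omega)
  have h12 := h.ne (i := 1) (j := 2) (by omega) (by omega) (by omega)
  have l0 := h.label 0 (by omega)
  have l1 := h.label 1 (by omega)
  have l2 := h.label 2 (by omega)
  have f0 := fun h0 => h.flat 0 (by omega) h0 2 (by omega)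
  have f1 := fun h0 => h.flat 1 (by omega) h0 0 (by omega)
  have f2 := fun h0 => h.flat 2 (by omega) h0 1 (by omega)
  norm_num [cycNext] at f0 f1 f2
  have ht : turning 3 x e = e 0 * edgeTurn (x 2) (x 0) (x 1) (x 2)
      + e 1 * edgeTurn (x 0) (x 1) (x 2) (x 0) + e 2 * edgeTurn (x 1) (x 2) (x 0) (x 1) := by
    simp [turning, Finset.sum_range_succ, cycNext, cycPrev]
  have hs : ∀ a b : ℤ, stepSign a b = 1 ∨ stepSign a b = -1 := fun a b => by
    unfold stepSign; split_ifs <;> omega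
  have hfin : ∀ u v : ℤ, (u = 1 ∨ u = 0 ∨ u = -1) → u ≠ 0 → (v = 1 ∨ v = -1) →
      u * (4 * v) = 4 ∨ u * (4 * v) = -4 := by
    rintro u v (rfl | rfl | rfl) hu (rfl | rfl) <;> omega
  have hone := between_trichotomy h01 h02 h12
  rw [ht]
  rcases hone with ⟨b0, b1, b2⟩ | ⟨b0, b1, b2⟩ | ⟨b0, b1, b2⟩
  · rw [edgeTurn_of_between b0, edgeTurn_eq_zero h01 h02 h01 h02 b1 b1,
      edgeTurn_eq_zero h12 h01.symm h12 h01.symm b2 b2, mul_zero, mul_zero, add_zero,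
      add_zero]
    exact hfin _ _ l0 (fun h => f0 h b0) (hs _ _)
  · rw [edgeTurn_of_between b1,
      edgeTurn_eq_zero h02.symm h12.symm h02.symm h12.symm b0 b0,
      edgeTurn_eq_zero h12 h01.symm h12 h01.symm b2 b2, mul_zero, mul_zero, add_zero,
      zero_add]
    exact hfin _ _ l1 (fun h => f1 h b1) (hs _ _)
  · rw [edgeTurn_of_between b2,
      edgeTurn_eq_zero h02.symm h12.symm h02.symm h12.symm b0 b0,
      edgeTurn_eq_zero h01 h02 h01 h02 b1 b1, mul_zero, mul_zero, zero_add,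
      zero_add]
    exact hfin _ _ l2 (fun h => f2 h b2) (hs _ _)

theorem contract {m : ℕ} (h : ArcCycle (m + 4) x e) (h0 : e (m + 3) = 0)
    (hne : e (m + 2) ≠ e 0 ∨ e (m + 2) = 0) :
    ArcCycle (m + 3) x e ∧ turning (m + 3) x e = turning (m + 4) x e := by
  have hf := h.flat (m + 3) (by omega) h0
  have n2 : cycNext (m + 4) (m + 2) = m + 3 := cycNext_of_lt (by omega)
  have n3 : cycNext (m + 4) (m + 3) = 0 := cycNext_last _
  have n4 : cycNext (m + 3) (m + 2) = 0 := cycNext_last _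
  rw [n3] at hf
  have hp : ∀ i < m + 3, x i ≠ x (m + 3) := fun i hi => h.ne (by omega) (by omega) (by omega)
  have f2 := hf (m + 2) (by omega)
  have p2 := hp (m + 2) (by omega)
  have p0 := hp 0 (by omega)
  have d20 := h.ne (i := m + 2) (j := 0) (by omega) (by omega) (by omega)
  have nx : ∀ i < m + 3, i = m + 2 ∨
      (i < m + 2 ∧ cycNext (m + 3) i = i + 1 ∧ cycNext (m + 4) i = i + 1) := by
    intro i hi
    by_cases hi' : i = m + 2
    · exact Or.inl hi'
    · exact Or.inr ⟨by omega, cycNext_of_lt (by omega), cycNext_of_lt (by omega)⟩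
  have hnew : ∀ j < m + 2, e (m + 2) = e j → e (m + 2) ≠ 0 →
      NonCrossing (x (m + 2)) (x 0) (x j) (x (j + 1)) ∧
      NonCrossing (x j) (x (j + 1)) (x (m + 2)) (x 0) := by
    intro j hj hej he0
    have nj : cycNext (m + 4) j = j + 1 := cycNext_of_lt (by omega)
    have c1 := h.nonCrossing (m + 2) (by omega) j (by omega) hej he0
    have c2 := h.nonCrossing j (by omega) (m + 2) (by omega) hej.symm (hej ▸ he0)
    rw [n2, nj] at c1 c2
    have fj := hf j (by omega)
    have fj' := hf (j + 1) (by omega)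
    have pj := hp j (by omega)
    have pj' := hp (j + 1) (by omega)
    clear hf hp nx h
    unfold NonCrossing Between Outside at *
    constructor <;> omega
  constructor
  · constructor
    · exact fun i hi j hj => h.inj i (by omega) j (by omega)
    · exact fun i hi => h.label i (by omega)
    · intro i hi j hj hij hi0
      rcases nx i hi with rfl | ⟨hi1, hi2, hi3⟩ <;> rcases nx j hj with rfl | ⟨hj1, hj2, hj3⟩
      · unfold NonCrossing Between Outside
        omega
      · rw [n4, hj2]
        exact (hnew j hj1 hij hi0).1
      · rw [n4, hi2]
        exact (hnew i hi1 hij.symm (hij ▸ hi0)).2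
      · have := h.nonCrossing i (by omega) j (by omega) hij hi0
        rwa [hi3, hj3, ← hi2, ← hj2] at this
    · intro i hi hi0 j hj
      rcases nx i hi with rfl | ⟨hi1, hi2, hi3⟩
      · have := h.flat (m + 2) (by omega) hi0 j (by omega)
        rw [n2] at this
        rw [n4]
        have fj := hf j (by omega)
        have pj := hp j (by omega)
        clear hf hp nx h hnew
        unfold Between at *
        omega
      · have := h.flat i (by omega) hi0 j (by omega)
        rwa [hi3, ← hi2] at this
    · intro i hi hie
      rcases nx i hi with rfl | ⟨hi1, hi2, hi3⟩
      · rw [n4] at hie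
        tauto
      · rw [hi2, ← hi3] at hie
        exact h.alternating i (by omega) hie
  · have f1 := hf (m + 1) (by omega)
    have fb := hf 1 (by omega)
    have p1 := hp (m + 1) (by omega)
    have pb := hp 1 (by omega)
    have d21 := h.ne (i := m + 2) (j := 1) (by omega) (by omega) (by omega)
    have d01 := h.ne (i := 0) (j := 1) (by omega) (by omega) (by omega)
    have d12 := h.ne (i := m + 1) (j := m + 2) (by omega) (by omega) (by omega)
    have d10 := h.ne (i := m + 1) (j := 0) (by omega) (by omega) (by omega)
    have H1 : stepSign (x (m + 2)) (x (m + 3)) = stepSign (x (m + 2)) (x 0) := by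
      unfold Between at f2
      unfold stepSign
      split_ifs <;> omega
    have H2 : cycSign (x (m + 1)) (x (m + 2)) (x (m + 3)) =
        cycSign (x (m + 1)) (x (m + 2)) (x 0) := by
      unfold Between at f1 f2
      unfold cycSign
      split_ifs <;> omega
    have H3 : cycSign (x (m + 2)) (x (m + 3)) (x 0) = stepSign (x (m + 3)) (x 0) := by
      unfold Between at f2
      unfold cycSign stepSign
      split_ifs <;> omega
    have H4 : cycSign (x (m + 3)) (x 0) (x 1) = stepSign (x (m + 3)) (x 0) := by
      unfold Between at fb
      unfold cycSign stepSign
      split_ifs <;> omega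
    have H5 : (e (m + 2) + e 0) *
        (cycSign (x (m + 2)) (x 0) (x 1) - stepSign (x (m + 3)) (x 0)) = 0 := by
      have hsum : e (m + 2) + e 0 = 0 ∨ e (m + 2) = 0 ∨ e 0 = 0 := by
        have := h.label (m + 2) (by omega)
        have := h.label 0 (by omega)
        omega
      rcases hsum with hs | hs | hs
      · rw [hs, zero_mul]
      · have g1 := h.flat _ (by omega) hs 0 (by omega)
        have g2 := h.flat _ (by omega) hs 1 (by omega)
        rw [n2] at g1 g2
        refine mul_eq_zero_of_right _ (sub_eq_zero.2 ?_)
        unfold Between at *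
        unfold cycSign stepSign
        split_ifs <;> omega
      · have g1 := h.flat _ (by omega) hs (m + 2) (by omega)
        have g2 := h.flat _ (by omega) hs (m + 3) (by omega)
        rw [cycNext_of_lt (by omega), zero_add] at g1 g2
        refine mul_eq_zero_of_right _ (sub_eq_zero.2 ?_)
        unfold Between at *
        unfold cycSign stepSign
        split_ifs <;> omega
    unfold turning
    rw [Finset.sum_range_succ, Finset.sum_range_succ _ (m + 1), Finset.sum_range_succ' _ m,
      Finset.sum_range_succ _ (m + 3), Finset.sum_range_succ _ (m + 2),
      Finset.sum_range_succ _ (m + 1), Finset.sum_range_succ' _ m, n2, n3, n4]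
    have hs : ∀ k ∈ Finset.range m, e (k + 1) * edgeTurn (x (cycPrev (m + 3) (k + 1))) (x (k + 1))
        (x (cycNext (m + 3) (k + 1))) (x (cycNext (m + 3) (cycNext (m + 3) (k + 1)))) =
        e (k + 1) * edgeTurn (x (cycPrev (m + 4) (k + 1))) (x (k + 1))
        (x (cycNext (m + 4) (k + 1))) (x (cycNext (m + 4) (cycNext (m + 4) (k + 1)))) := by
      intro k hk
      have := Finset.mem_range.1 hk
      simp only [cycPrev, cycNext_of_lt (n := m + 3) (k := k + 1) (by omega),
        cycNext_of_lt (n := m + 4) (k := k + 1) (by omega),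
        cycNext_of_lt (n := m + 3) (k := k + 1 + 1) (by omega),
        cycNext_of_lt (n := m + 4) (k := k + 1 + 1) (by omega)]
      rfl
    rw [Finset.sum_congr rfl hs, cycNext_of_lt (n := m + 3) (k := m + 1) (by omega),
      cycNext_of_lt (n := m + 4) (k := m + 1) (by omega),
      cycNext_of_lt (n := m + 3) (k := 0) (by omega),
      cycNext_of_lt (n := m + 4) (k := 0) (by omega),
      cycNext_of_lt (n := m + 3) (k := 0 + 1) (by omega),
      cycNext_of_lt (n := m + 4) (k := 0 + 1) (by omega), n2, n4]
    simp only [cycPrev, edgeTurn, Nat.add_eq_zero_iff, one_ne_zero, OfNat.ofNat_ne_zero, and_false,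
      if_true, if_false, zero_add, H1, H2, H3, H4, h0, Nat.reduceSubDiff,
      Nat.add_one_sub_one]
    linear_combination -H5

/-- The turning number of a simple closed curve is `± 1`. -/
theorem turning_eq (hn : 3 ≤ n) :
    ∀ x e : ℕ → ℤ, ArcCycle n x e → turning n x e = 4 ∨ turning n x e = -4 := by
  induction n, hn using Nat.le_induction with
  | base => exact fun x e h => h.turning_three
  | succ n hn ih =>
    intro x e h
    rw [← h.turning_relabel (by omega)]
    have h' := h.relabel
    by_cases h0 : ∀ i < n + 1, _root_.relabel (n + 1) e i ≠ 0
    · rw [h'.turning_eq_two_mul_arcSum h0]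
      have := h'.arcSum_eq (n + 1) _ _ (by omega) h0
      omega
    · push Not at h0
      obtain ⟨i, hi, hi0⟩ := h0
      obtain ⟨m, rfl⟩ : ∃ m, n = m + 3 := ⟨n - 3, by omega⟩
      obtain ⟨c, hc, hci⟩ := exists_cycRot_eq (j := m + 3) hi (by omega)
      have hnb := relabel_neighbours hi hi0
      rw [← hci] at hnb hi0
      rw [← cycRot_cycNext hc (by omega), ← cycRot_cycPrev hc (by omega), cycNext_last] at hnb
      obtain ⟨h2, hs⟩ := (h'.rotate hc).contract hi0 hnb
      rw [← turning_rotate hc, ← hs]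
      exact ih _ _ h2

end ArcCycle

section Height

variable {K : ℕ} {A : Type} (h : CRAlphabet K A) (s : Fin K)

/-- The change of the height of stack `s` caused by a letter. -/
def letterHeight (a : A) : ℤ :=
  match h.kind a with
  | .call t => if t = s then 1 else 0
  | .ret t => if t = s then -1 else 0
  | .int => 0

/-- The change of the height of stack `s` caused by a string. -/
def wordHeight (u : List A) : ℤ := (u.map (letterHeight h s)).sum

variable {h s}

theorem letterHeight_call {a : A} (ha : a ∈ h.callSet s) : letterHeight h s a = 1 := by
  have : h.kind a = .call s := ha
  simp [letterHeight, this]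

theorem letterHeight_ret {a : A} (ha : a ∈ h.retSet s) : letterHeight h s a = -1 := by
  have : h.kind a = .ret s := ha
  simp [letterHeight, this]

theorem letterHeight_of_notMem {a : A} (hc : a ∉ h.callSet s) (hr : a ∉ h.retSet s) :
    letterHeight h s a = 0 := by
  have hc : h.kind a ≠ .call s := hc
  have hr : h.kind a ≠ .ret s := hr
  unfold letterHeight
  split
  · rw [if_neg]
    rintro rfl
    exact hc ‹_›
  · rw [if_neg]
    rintro rfl
    exact hr ‹_›
  · rfl

@[simp] theorem wordHeight_nil : wordHeight h s [] = 0 := rfl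

@[simp] theorem wordHeight_cons (a : A) (u : List A) :
    wordHeight h s (a :: u) = letterHeight h s a + wordHeight h s u := by
  simp [wordHeight]

@[simp] theorem wordHeight_append (u v : List A) :
    wordHeight h s (u ++ v) = wordHeight h s u + wordHeight h s v := by
  simp [wordHeight]

theorem SWellFormed.wordHeight {u : List A} (hu : SWellFormed (h.callSet s) (h.retSet s) u) :
    wordHeight h s u = 0 ∧ ∀ k, 0 ≤ wordHeight h s (u.take k) := by
  induction hu with
  | nil => simp
  | @single x hc hr =>
    have hx := letterHeight_of_notMem hc hr
    refine ⟨by simp [hx], fun k => ?_⟩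
    cases k <;> simp [hx]
  | @wrap a b u ha hb _ ih =>
    have ha := letterHeight_call ha
    have hb := letterHeight_ret hb
    refine ⟨by simp [ha, hb, ih.1], fun k => ?_⟩
    rcases k with _ | k
    · simp
    · have h1 := ih.2 k
      have h2 : -1 ≤ _root_.wordHeight h s ([b].take (k - u.length)) := by
        cases k - u.length <;> simp [hb]
      simp only [List.cons_append, List.take_succ_cons, wordHeight_cons, List.take_append,
        wordHeight_append, ha]
      omega
  | @concat u v _ _ ihu ihv =>
    refine ⟨by simp [ihu.1, ihv.1], fun k => ?_⟩
    rw [List.take_append, wordHeight_append]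
    exact add_nonneg (ihu.2 _) (ihv.2 _)

namespace Matched

variable {w : List A} {t : Fin K} {i j i' j' : ℕ}

theorem height_lt (hm : Matched h w s i j) {k : ℕ} (hik : i < k) (hkj : k ≤ j) :
    wordHeight h s (w.take i) < wordHeight h s (w.take k) := by
  obtain ⟨_, _, ⟨a, hia, ha⟩, _, hu⟩ := hm
  obtain ⟨l, rfl⟩ : ∃ l, k = i + 1 + l := ⟨k - (i + 1), by omega⟩
  have := hu.wordHeight.2 l
  rw [List.drop_take, List.take_take, min_eq_left (by omega)] at this
  rw [List.take_add, List.take_add_one, hia]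
  simp only [wordHeight_append, Option.toList_some, wordHeight_cons, wordHeight_nil,
    letterHeight_call ha]
  omega

theorem height_succ (hm : Matched h w s i j) :
    wordHeight h s (w.take (j + 1)) = wordHeight h s (w.take i) := by
  obtain ⟨hij, _, ⟨a, hia, ha⟩, ⟨b, hjb, hb⟩, hu⟩ := hm
  have := hu.wordHeight.1
  rw [List.drop_take] at this
  obtain ⟨l, rfl⟩ : ∃ l, j = i + 1 + l := ⟨j - (i + 1), by omega⟩
  rw [Nat.add_sub_cancel_left] at this
  rw [List.take_add_one, hjb, List.take_add, List.take_add_one, hia]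
  simp only [wordHeight_append, Option.toList_some, wordHeight_cons, wordHeight_nil,
    letterHeight_call ha, letterHeight_ret hb]
  omega

theorem not_interleaved (hm : Matched h w s i j) (hm' : Matched h w s i' j') :
    ¬ (i < i' ∧ i' ≤ j ∧ j < j') := by
  rintro ⟨h1, h2, h3⟩
  have a := hm.height_lt h1 h2
  have b := hm.height_succ
  have c := hm'.height_lt (k := j + 1) (by omega) (by omega)
  omega

theorem not_call_ret (hm : Matched h w s i j) (hm' : Matched h w t j j') : False := by
  obtain ⟨_, _, _, ⟨a, hia, ha⟩, _⟩ := hm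
  obtain ⟨_, _, ⟨b, hib, hb⟩, _⟩ := hm'
  obtain rfl : a = b := Option.some_injective _ (hia.symm.trans hib)
  have ha : h.kind a = .ret s := ha
  have hb : h.kind a = .call t := hb
  rw [ha] at hb
  cases hb

theorem left_unique (hm : Matched h w s i j) (hm' : Matched h w t i' j) : s = t ∧ i = i' := by
  have hst : s = t := by
    obtain ⟨_, _, _, ⟨a, hia, ha⟩, _⟩ := hm
    obtain ⟨_, _, _, ⟨b, hib, hb⟩, _⟩ := hm'
    obtain rfl : a = b := Option.some_injective _ (hia.symm.trans hib)
    have ha : h.kind a = .ret s := ha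
    have hb : h.kind a = .ret t := hb
    rw [ha] at hb
    cases hb
    rfl
  subst hst
  refine ⟨rfl, ?_⟩
  have h1 := hm.1
  have h2 := hm'.1
  have e1 := hm.height_succ
  have e2 := hm'.height_succ
  rcases lt_trichotomy i i' with hlt | heq | hlt
  · have := hm.height_lt hlt (by omega)
    omega
  · exact heq
  · have := hm'.height_lt hlt (by omega)
    omega

theorem right_unique (hm : Matched h w s i j) (hm' : Matched h w t i j') : s = t ∧ j = j' := by
  have hst : s = t := by
    obtain ⟨_, _, ⟨a, hia, ha⟩, _⟩ := hm
    obtain ⟨_, _, ⟨b, hib, hb⟩, _⟩ := hm'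
    obtain rfl : a = b := Option.some_injective _ (hia.symm.trans hib)
    have ha : h.kind a = .call s := ha
    have hb : h.kind a = .call t := hb
    rw [ha] at hb
    cases hb
    rfl
  subst hst
  refine ⟨rfl, ?_⟩
  have h1 := hm.1
  have h2 := hm'.1
  have e1 := hm.height_succ
  have e2 := hm'.height_succ
  rcases lt_trichotomy j j' with hlt | heq | hlt
  · have := hm'.height_lt (k := j + 1) (by omega) (by omega)
    omega
  · exact heq
  · have := hm.height_lt (k := j' + 1) (by omega) (by omega)
    omega

end Matched

end Height

namespace Dir

/-- The half plane in which an edge is drawn; `0` for the edges of the line itself. -/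
def side : Dir → ℤ
  | right | left => 0
  | call1 | ret1 => 1
  | call2 | ret2 => -1

/-- The orientation of an edge. -/
def sign : Dir → ℤ
  | right | call1 | call2 => 1
  | left | ret1 | ret2 => -1

/-- The cyclic orientation of the points visited by two consecutive steps of a simple cycle, at
least one of which is an edge of the line. -/
def corner (d d' : Dir) : ℤ := if d.side = 0 then d.sign else d'.sign

/-- The turning contributed by a step, given the preceding and the following one. -/
def turn (d₀ d d₁ : Dir) : ℤ := d.side * (2 * d.sign - corner d₀ d - corner d d₁)

end Dir

section Step

variable {A : Type} {h : CRAlphabet 2 A} {w : List A} {d d' : Dir} {a b c : ℕ}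

theorem dirStep.lt_or_lt (hs : dirStep h w d a b) :
    d.sign = 1 ∧ a < b ∨ d.sign = -1 ∧ b < a := by
  cases d
  · exact Or.inl ⟨rfl, by have := hs.1; omega⟩
  · exact Or.inr ⟨rfl, by have := hs.1; omega⟩
  · exact Or.inl ⟨rfl, hs.1⟩
  · exact Or.inr ⟨rfl, hs.1⟩
  · exact Or.inl ⟨rfl, hs.1⟩
  · exact Or.inr ⟨rfl, hs.1⟩

theorem dirStep.stepSign (hs : dirStep h w d a b) : stepSign a b = d.sign := by
  have := hs.lt_or_lt
  unfold _root_.stepSign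
  split_ifs <;> omega

theorem dirStep.adjacent (hs : dirStep h w d a b) (hd : d.side = 0) : b = a + 1 ∨ a = b + 1 := by
  cases d <;> simp only [dirStep, Dir.side] at * <;> omega

theorem dirStep.matched (hs : dirStep h w d a b) (hd : d.side ≠ 0) :
    ∃ s : Fin 2, (s = 0 ↔ d.side = 1) ∧
      (d.sign = 1 ∧ Matched h w s a b ∨ d.sign = -1 ∧ Matched h w s b a) := by
  cases d
  · exact absurd rfl hd
  · exact absurd rfl hd
  · exact ⟨0, by simp [Dir.side], Or.inl ⟨rfl, hs⟩⟩
  · exact ⟨0, by simp [Dir.side], Or.inr ⟨rfl, hs⟩⟩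
  · exact ⟨1, by simp [Dir.side], Or.inl ⟨rfl, hs⟩⟩
  · exact ⟨1, by simp [Dir.side], Or.inr ⟨rfl, hs⟩⟩

/-- Two consecutive matching edges backtrack. -/
theorem dirStep.matched_matched (hs : dirStep h w d a b) (hs' : dirStep h w d' b c)
    (hd : d.side ≠ 0) (hd' : d'.side ≠ 0) (hac : a ≠ c) : False := by
  obtain ⟨s, -, ⟨-, hm⟩ | ⟨-, hm⟩⟩ := hs.matched hd <;>
    obtain ⟨s', -, ⟨-, hm'⟩ | ⟨-, hm'⟩⟩ := hs'.matched hd'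
  · exact hm.not_call_ret hm'
  · exact hac (hm.left_unique hm').2
  · exact hac (hm.right_unique hm').2
  · exact hm'.not_call_ret hm

theorem dirStep.cycSign (hs : dirStep h w d a b) (hs' : dirStep h w d' b c) (hac : a ≠ c) :
    cycSign a b c = Dir.corner d d' := by
  have h1 := hs.lt_or_lt
  have h2 := hs'.lt_or_lt
  have h3 := hs.adjacent
  have h4 := hs'.adjacent
  have h5 := fun hd hd' => hs.matched_matched hs' hd hd' hac
  clear hs hs'
  unfold _root_.cycSign
  cases d <;> cases d' <;> simp [Dir.side, Dir.sign, Dir.corner] at * <;> omega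

theorem dirStep.two_cycle (hs : dirStep h w d a b) (hs' : dirStep h w d' b a) :
    (∀ {A : Type} {h : CRAlphabet 2 A} {w : List A} {i j k : ℕ},
      dirStep h w d i j → dirStep h w d' j k → k ≤ i) ∨
    (∀ {A : Type} {h : CRAlphabet 2 A} {w : List A} {i j k : ℕ},
      dirStep h w d i j → dirStep h w d' j k → i ≤ k) := by
  by_cases hd : d.side = 0
  · have h2 := hs.lt_or_lt
    have h3 := hs'.lt_or_lt
    rcases h2 with h2 | h2
    · left
      intro A h w i j k g g'
      have g1 := g.adjacent hd
      have g2 := g.lt_or_lt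
      have g3 := g'.lt_or_lt
      omega
    · right
      intro A h w i j k g g'
      have g1 := g.adjacent hd
      have g2 := g.lt_or_lt
      have g3 := g'.lt_or_lt
      omega
  by_cases hd' : d'.side = 0
  · have h2 := hs.lt_or_lt
    have h3 := hs'.lt_or_lt
    rcases h2 with h2 | h2
    · right
      intro A h w i j k g g'
      have g1 := g'.adjacent hd'
      have g2 := g.lt_or_lt
      have g3 := g'.lt_or_lt
      omega
    · left
      intro A h w i j k g g'
      have g1 := g'.adjacent hd'
      have g2 := g.lt_or_lt
      have g3 := g'.lt_or_lt
      omega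
  · left
    intro A h w i j k g g'
    by_contra hk
    exact g.matched_matched g' hd hd' (by omega)

theorem NonCrossing.swap_left {a b c d : ℤ} (h : NonCrossing a b c d) : NonCrossing b a c d := by
  unfold NonCrossing Between Outside at *
  omega

theorem NonCrossing.swap_right {a b c d : ℤ} (h : NonCrossing a b c d) : NonCrossing a b d c := by
  unfold NonCrossing Between Outside at *
  omega

theorem Matched.nonCrossing {s : Fin 2} {i j i' j' : ℕ} (hm : Matched h w s i j)
    (hm' : Matched h w s i' j') : NonCrossing i j i' j' := by
  have h1 := hm.not_interleaved hm'
  have h2 := hm'.not_interleaved hm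
  have h3 := hm.1
  have h4 := hm'.1
  unfold NonCrossing Between Outside
  omega

theorem dirStep.nonCrossing {a' b' : ℕ} (hs : dirStep h w d a b) (hs' : dirStep h w d' a' b')
    (he : d.side = d'.side) (hd : d.side ≠ 0) : NonCrossing a b a' b' := by
  obtain ⟨s, hsd, hm⟩ := hs.matched hd
  obtain ⟨s', hsd', hm'⟩ := hs'.matched (he ▸ hd)
  obtain rfl : s = s' := by
    rw [he, ← hsd'] at hsd
    omega
  rcases hm with ⟨-, hm⟩ | ⟨-, hm⟩ <;> rcases hm' with ⟨-, hm'⟩ | ⟨-, hm'⟩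
  · exact hm.nonCrossing hm'
  · exact (hm.nonCrossing hm').swap_right
  · exact (hm.nonCrossing hm').swap_left
  · exact (hm.nonCrossing hm').swap_left.swap_right

end Step

/-- The positions `p 0, …, p (n - 1)` form a simple cycle labelled `D 0, …, D (n - 1)`. -/
structure IsDirCycle {A : Type} (h : CRAlphabet 2 A) (w : List A) (n : ℕ) (D : ℕ → Dir)
    (p : ℕ → ℕ) : Prop where
  step : ∀ k < n, dirStep h w (D k) (p k) (p (cycNext n k))
  inj : ∀ i < n, ∀ j < n, p i = p j → i = j

theorem dirPath.length_and_step {A : Type} {h : CRAlphabet 2 A} {w : List A} {ds : List Dir} :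
    ∀ {is : List ℕ}, dirPath h w ds is → is.length = ds.length + 1 ∧
      ∀ k d, ds[k]? = some d → dirStep h w d (is.getD k 0) (is.getD (k + 1) 0) := by
  induction ds with
  | nil =>
    rintro is ⟨i, rfl⟩
    simp
  | cons d ds ih =>
    rintro is ⟨i, j, rest, rfl, hs, hp⟩
    obtain ⟨hl, hst⟩ := ih hp
    refine ⟨by simpa using hl, ?_⟩
    rintro (_ | k) d' hd'
    · obtain rfl : d = d' := by simpa using hd'
      simpa using hs
    · have := hst k d' (by simpa using hd')
      simpa using this

theorem SimpleCycle.exists_isDirCycle {A : Type} {h : CRAlphabet 2 A} {w : List A}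
    {ds : List Dir} {i : ℕ} (hc : SimpleCycle h w ds i) {D : ℕ → Dir}
    (hD : ∀ k < ds.length, ds[k]? = some (D k)) :
    ∃ p, IsDirCycle h w ds.length D p := by
  obtain ⟨is, hp, hhead, hlast, hnd⟩ := hc
  obtain ⟨hl, hst⟩ := hp.length_and_step
  have h0 : is.getD 0 0 = i := by
    rw [List.head?_eq_getElem?] at hhead
    rw [List.getD_eq_getElem?_getD, hhead, Option.getD_some]
  have hn : is.getD ds.length 0 = i := by
    rw [List.getLast?_eq_getElem?, hl, Nat.add_sub_cancel] at hlast
    rw [List.getD_eq_getElem?_getD, hlast, Option.getD_some]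
  refine ⟨fun k => is.getD k 0, fun k hk => ?_, fun a ha b hb hab => ?_⟩
  · have := hst k _ (hD k hk)
    unfold cycNext
    split_ifs with hk'
    · exact this
    · rw [show k + 1 = ds.length by omega, hn, ← h0] at this
      exact this
  · have hdl : is.dropLast.length = ds.length := by simp [hl]
    refine (hnd.getElem_inj_iff (hi := by omega) (hj := by omega)).1 ?_
    rw [List.getElem_dropLast, List.getElem_dropLast]
    simpa [List.getD_eq_getElem?_getD, List.getElem?_eq_getElem (show a < is.length by omega),
      List.getElem?_eq_getElem (show b < is.length by omega)] using hab

/-- Twice the turning number, in half turns, of any simple cycle labelled `D 0, …, D (n - 1)`. -/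
def dirTurning (n : ℕ) (D : ℕ → Dir) : ℤ :=
  ∑ k ∈ Finset.range n, Dir.turn (D (cycPrev n k)) (D k) (D (cycNext n k))

namespace IsDirCycle

variable {A : Type} {h : CRAlphabet 2 A} {w : List A} {n : ℕ} {D : ℕ → Dir} {p : ℕ → ℕ}

theorem ne_next_next (hc : IsDirCycle h w n D p) (hn : 3 ≤ n) {k : ℕ} (hk : k < n) :
    p k ≠ p (cycNext n (cycNext n k)) := by
  intro he
  have := hc.inj _ hk _ (cycNext_lt (cycNext_lt hk)) he
  unfold cycNext at this
  split_ifs at this <;> omega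

theorem arcCycle (hc : IsDirCycle h w n D p) (hn : 3 ≤ n) :
    ArcCycle n (fun k => p k) (fun k => (D k).side) where
  inj i hi j hj hij := hc.inj i hi j hj (by exact_mod_cast hij)
  label i _ := by cases D i <;> simp [Dir.side]
  nonCrossing i hi j hj he hi0 := (hc.step i hi).nonCrossing (hc.step j hj) he hi0
  flat i hi h0 j _ := by
    have := (hc.step i hi).adjacent h0
    unfold Between
    omega
  alternating i hi he := by
    by_contra hi0
    exact (hc.step i hi).matched_matched (hc.step _ (cycNext_lt hi)) hi0 (he ▸ hi0)
      (hc.ne_next_next hn hi)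

theorem turning_eq (hc : IsDirCycle h w n D p) (hn : 3 ≤ n) :
    turning n (fun k => p k) (fun k => (D k).side) = dirTurning n D := by
  refine Finset.sum_congr rfl fun k hk => ?_
  have hk := Finset.mem_range.1 hk
  have h0 := hc.step _ (cycPrev_lt hk)
  have h2 := hc.ne_next_next hn (cycPrev_lt hk)
  rw [cycNext_cycPrev hk] at h0 h2
  simp only [edgeTurn, Dir.turn]
  rw [(hc.step k hk).stepSign, h0.cycSign (hc.step k hk) h2,
    (hc.step k hk).cycSign (hc.step _ (cycNext_lt hk)) (hc.ne_next_next hn hk)]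

theorem dirTurning_eq (hc : IsDirCycle h w n D p) (hn : 3 ≤ n) :
    dirTurning n D = 4 ∨ dirTurning n D = -4 :=
  hc.turning_eq hn ▸ (hc.arcCycle hn).turning_eq hn _ _

end IsDirCycle

theorem dirTurning_mul {n k : ℕ} (hn : 0 < n) (hk : 0 < k) {D : ℕ → Dir}
    (hD : ∀ i, D (i % n) = D i) : dirTurning (k * n) D = k * dirTurning n D := by
  have hmod : ∀ {i j}, i % n = j % n → D i = D j := fun {i j} hij => by
    rw [← hD i, hij, hD j]
  have hG : ∀ k, 0 < k → dirTurning (k * n) D =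
      ∑ j ∈ Finset.range (k * n), Dir.turn (D (j + n - 1)) (D j) (D (j + 1)) := by
    intro k hk
    refine Finset.sum_congr rfl fun j hj => ?_
    have hj := Finset.mem_range.1 hj
    congr 1
    · apply hmod
      unfold cycPrev
      split_ifs with hj0
      · obtain ⟨l, rfl⟩ : ∃ l, k = l + 1 := ⟨k - 1, by omega⟩
        rw [hj0, show (l + 1) * n - 1 = 0 + n - 1 + n * l by
          rw [add_mul, mul_comm l n]; omega, Nat.add_mul_mod_self_left]
      · rw [show j + n - 1 = j - 1 + n by omega, Nat.add_mod_right]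
    · apply hmod
      unfold cycNext
      split_ifs with hj1
      · rfl
      · rw [show j + 1 = k * n by omega, Nat.mul_mod_left, Nat.zero_mod]
  have h1 := hG 1 one_pos
  rw [one_mul] at h1
  rw [hG k hk, h1]
  clear hk
  induction k with
  | zero => simp
  | succ k ih =>
    rw [add_mul, one_mul, Finset.sum_range_add, ih]
    have : ∀ j ∈ Finset.range n, Dir.turn (D (k * n + j + n - 1)) (D (k * n + j))
        (D (k * n + j + 1)) = Dir.turn (D (j + n - 1)) (D j) (D (j + 1)) := by
      intro j _
      rw [show k * n + j + n - 1 = j + n - 1 + n * k by rw [mul_comm]; omega,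
        show k * n + j = j + n * k by ring, show j + n * k + 1 = j + 1 + n * k by ring,
        hmod (Nat.add_mul_mod_self_left (j + n - 1) n k), hmod (Nat.add_mul_mod_self_left j n k),
        hmod (Nat.add_mul_mod_self_left (j + 1) n k)]
    rw [Finset.sum_congr rfl this]
    push_cast
    ring

theorem getElem?_flatten_replicate {α : Type*} (l : List α) (k j : ℕ) (hj : j < k * l.length) :
    (List.replicate k l).flatten[j]? = l[j % l.length]? := by
  induction k generalizing j with
  | zero => omega
  | succ k ih =>
    rw [List.replicate_succ, List.flatten_cons, List.getElem?_append]
    split_ifs with hjl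
    · rw [Nat.mod_eq_of_lt hjl]
    · rw [ih _ (by rw [add_mul] at hj; omega), ← Nat.mod_eq_sub_mod (by omega)]

/-- for every circular direction string `w ∈ Δ⁺` and every
`k ≥ 2`, the `k`-fold repetition `w^k` is not circular. -/
theorem stmt5 (ds : List Dir) (hne : ds ≠ []) (hc : Circular ds) :
    ∀ k, 2 ≤ k → ¬ Circular (List.replicate k ds).flatten := by
  rintro k hk ⟨A', h', w', i', hc'⟩
  obtain ⟨A, h, w, i, hc⟩ := hc
  have hpos : 0 < ds.length := List.length_pos_iff.2 hne
  let D : ℕ → Dir := fun j => ds.getD (j % ds.length) .right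
  have hD : ∀ j, ds[j % ds.length]? = some (D j) := fun j => by
    have := Nat.mod_lt j hpos
    simp [D, List.getD_eq_getElem?_getD, List.getElem?_eq_getElem this]
  have hDmod : ∀ j, D (j % ds.length) = D j := fun j => by simp [D]
  obtain ⟨p, hp⟩ := hc.exists_isDirCycle (D := D) fun j hj => by
    rw [← hD, Nat.mod_eq_of_lt hj]
  have hlen : (List.replicate k ds).flatten.length = k * ds.length := by simp
  obtain ⟨p', hp'⟩ := hc'.exists_isDirCycle (D := D) fun j hj => by
    rw [← hD, getElem?_flatten_replicate _ _ _ (hlen ▸ hj)]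
  rw [hlen] at hp'
  generalize ds.length = n at *
  have hkn : 2 * n ≤ k * n := Nat.mul_le_mul_right n hk
  obtain rfl | rfl | hn : n = 1 ∨ n = 2 ∨ 3 ≤ n := by omega
  · have := (hp.step 0 one_pos).lt_or_lt
    rw [cycNext_last] at this
    omega
  · have s0 := hp.step 0 (by omega)
    have s1 := hp.step 1 (by omega)
    have hstep : ∀ j < k, dirStep h' w' (D 0) (p' (2 * j)) (p' (2 * j + 1)) ∧
        dirStep h' w' (D 1) (p' (2 * j + 1)) (p' (cycNext (k * 2) (2 * j + 1))) := by
      intro j hj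
      have t0 := hp'.step (2 * j) (by omega)
      have t1 := hp'.step (2 * j + 1) (by omega)
      rw [cycNext_of_lt (by omega), ← hDmod, Nat.mul_mod_right] at t0
      rw [← hDmod, Nat.mul_add_mod] at t1
      exact ⟨t0, t1⟩
    have hback : p' (2 * (k - 1)) = p' 0 := by
      have hlast : cycNext (k * 2) (2 * (k - 1) + 1) = 0 := if_neg (by omega)
      have hl := hstep (k - 1) (by omega)
      rw [hlast] at hl
      rcases s0.two_cycle s1 with hmono | hmono
      · have : ∀ j < k, p' (2 * j) ≤ p' 0 := by
          intro j
          induction j with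
          | zero => simp
          | succ j ih =>
            intro hj
            have := hstep j (by omega)
            rw [cycNext_of_lt (by omega)] at this
            exact (hmono this.1 this.2).trans (ih (by omega))
        exact le_antisymm (this _ (by omega)) (hmono hl.1 hl.2)
      · have : ∀ j < k, p' 0 ≤ p' (2 * j) := by
          intro j
          induction j with
          | zero => simp
          | succ j ih =>
            intro hj
            have := hstep j (by omega)
            rw [cycNext_of_lt (by omega)] at this
            exact (ih (by omega)).trans (hmono this.1 this.2)
        exact le_antisymm (hmono hl.1 hl.2) (this _ (by omega))
    have := hp'.inj _ (by omega) _ (by omega) hback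
    omega
  · have t := hp.dirTurning_eq hn
    have t' := hp'.dirTurning_eq (by omega)
    rw [dirTurning_mul (by omega) (by omega) hDmod] at t'
    have hk' : (2 : ℤ) ≤ k := by exact_mod_cast hk
    rcases t with t | t <;> rw [t] at t' <;> omega
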